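/- (Proposition 1, negative flows.) Let r : Fin (k+1) → X be limiting profiles satisfying Condition 2 (g (r h) j ≥ g (r l) j for all criteria j whenever h < l) and Condition 7.B (π(r h, r (h+1)) > 0 for every h < k), all profiles pairwise distinct, and let a be an alternative distinct from all profiles. Then for every h < k, the negative Choquet-flows over R_a = {r 0, …, r k, a} satisfy the strict inequality φ⁻_{R_a}(r h) < φ⁻_{R_a}(r (h+1)). -/

import Mathlib

open Finset

/-- The 2-additive Choquet integral (Möbius form). -/
noncomputable def CI2 (n : ℕ) (m : Fin n → ℝ) (M : Fin n → Fin n → ℝ)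
    (P : Fin n → ℝ) : ℝ :=
  ∑ j, m j * P j + ∑ j, ∑ s, if j < s then M j s * min (P j) (P s) else 0

/-- The Choquet-outranking degree of `x` over `y` built from evaluations `g` and
preference functions `F`. -/
noncomputable def outrank {X : Type*} (n : ℕ) (m : Fin n → ℝ) (M : Fin n → Fin n → ℝ)
    (g : X → Fin n → ℝ) (F : Fin n → ℝ → ℝ) (x y : X) : ℝ :=
  CI2 n m M (fun j => F j (g x j - g y j))

/-- The positive Choquet-flow of `x` within the finite set `S`. -/
noncomputable def posFlow {X : Type*} [DecidableEq X] (π : X → X → ℝ)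
    (S : Finset X) (x : X) : ℝ :=
  (1 / ((S.card : ℝ) - 1)) * ∑ y ∈ S.erase x, π x y

/-- The negative Choquet-flow of `x` within the finite set `S`. -/
noncomputable def negFlow {X : Type*} [DecidableEq X] (π : X → X → ℝ)
    (S : Finset X) (x : X) : ℝ :=
  (1 / ((S.card : ℝ) - 1)) * ∑ y ∈ S.erase x, π y x

/-- The net Choquet-flow of `x` within the finite set `S`. -/
noncomputable def netFlow {X : Type*} [DecidableEq X] (π : X → X → ℝ)
    (S : Finset X) (x : X) : ℝ :=
  posFlow π S x - negFlow π S x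

theorem CI2_eq_half_sum {n : ℕ} {m : Fin n → ℝ} {M : Fin n → Fin n → ℝ}
    (hsymm : ∀ j s, M j s = M s j) (hdiag : ∀ j, M j j = 0) (P : Fin n → ℝ) :
    CI2 n m M P = ∑ j, m j * P j + (∑ j, ∑ s, M j s * min (P j) (P s)) / 2 := by
  have hswap : (∑ j, ∑ s, if j < s then M j s * min (P j) (P s) else 0)
      = ∑ j, ∑ s, if s < j then M j s * min (P j) (P s) else 0 := by
    rw [Finset.sum_comm]
    refine Finset.sum_congr rfl fun j _ => Finset.sum_congr rfl fun s _ => ?_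
    rw [hsymm s j, min_comm]
  have hsplit : (∑ j, ∑ s, M j s * min (P j) (P s))
      = (∑ j, ∑ s, if j < s then M j s * min (P j) (P s) else 0)
        + ∑ j, ∑ s, if s < j then M j s * min (P j) (P s) else 0 := by
    simp only [← Finset.sum_add_distrib]
    refine Finset.sum_congr rfl fun j _ => Finset.sum_congr rfl fun s _ => ?_
    rcases lt_trichotomy j s with h | h | h
    · simp [h, h.not_gt]
    · subst h
      simp [hdiag]
    · simp [h, h.not_gt]
  unfold CI2
  linarith

theorem CI2_update_sub {n : ℕ} {m : Fin n → ℝ} {M : Fin n → Fin n → ℝ}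
    (hsymm : ∀ j s, M j s = M s j) (hdiag : ∀ j, M j j = 0)
    (P : Fin n → ℝ) (j : Fin n) (b : ℝ) :
    CI2 n m M (Function.update P j b) - CI2 n m M P
      = m j * (b - P j) + ∑ s, M j s * (min b (P s) - min (P j) (P s)) := by
  set Q := Function.update P j b with hQ
  set t : Fin n → ℝ := fun s => M j s * (min b (P s) - min (P j) (P s)) with ht
  have hlin : ∑ i, m i * Q i - ∑ i, m i * P i = m j * (b - P j) := by
    rw [← Finset.sum_sub_distrib, Finset.sum_eq_single j]
    · simp [hQ, mul_sub]
    · intro i _ hi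
      simp [hQ, hi]
    · simp
  have hquad : (∑ i, ∑ s, M i s * min (Q i) (Q s)) - ∑ i, ∑ s, M i s * min (P i) (P s)
      = 2 * ∑ s, t s := by
    have hterm : ∀ i s, M i s * min (Q i) (Q s) - M i s * min (P i) (P s)
        = (if i = j then t s else 0) + if s = j then t i else 0 := by
      intro i s
      by_cases hi : i = j <;> by_cases hs : s = j
      · subst hi
        subst hs
        simp [ht, hdiag]
      · subst hi
        simp [hQ, ht, hs, mul_sub]
      · subst hs
        simp [hQ, ht, hi, mul_sub, hsymm i s, min_comm]
      · simp [hQ, hi, hs]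
    simp only [← Finset.sum_sub_distrib, hterm, Finset.sum_add_distrib]
    rw [Finset.sum_comm]
    simp [two_mul]
  rw [CI2_eq_half_sum hsymm hdiag, CI2_eq_half_sum hsymm hdiag]
  linarith

theorem CI2_le_update {n : ℕ} {m : Fin n → ℝ} {M : Fin n → Fin n → ℝ}
    (hsymm : ∀ j s, M j s = M s j) (hdiag : ∀ j, M j j = 0)
    (hmono : ∀ j (S : Finset (Fin n)), j ∉ S → 0 ≤ m j + ∑ s ∈ S, M j s)
    (P : Fin n → ℝ) (j : Fin n) {b : ℝ} (hb : P j ≤ b) :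
    CI2 n m M P ≤ CI2 n m M (Function.update P j b) := by
  have hneg := hmono j (Finset.univ.filter fun s => M j s < 0) (by simp [hdiag])
  have hsum : (∑ s ∈ Finset.univ.filter (fun s => M j s < 0), M j s) * (b - P j)
      ≤ ∑ s, M j s * (min b (P s) - min (P j) (P s)) := by
    rw [Finset.sum_filter, Finset.sum_mul]
    refine Finset.sum_le_sum fun s _ => ?_
    have h0 : 0 ≤ min b (P s) - min (P j) (P s) :=
      sub_nonneg.2 (min_le_min_right _ hb)
    have h1 : min b (P s) - min (P j) (P s) ≤ b - P j := by
      rcases le_total (P j) (P s) with h | h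
      · rw [min_eq_left h]
        linarith [min_le_left b (P s)]
      · rw [min_eq_right h]
        linarith [min_le_right b (P s)]
    split_ifs with hM
    · exact mul_le_mul_of_nonpos_left h1 hM.le
    · rw [zero_mul]
      exact mul_nonneg (not_lt.1 hM) h0
  have hdiff := CI2_update_sub (m := m) hsymm hdiag P j b
  nlinarith [mul_nonneg hneg (sub_nonneg.2 hb)]

theorem CI2_mono {n : ℕ} {m : Fin n → ℝ} {M : Fin n → Fin n → ℝ}
    (hsymm : ∀ j s, M j s = M s j) (hdiag : ∀ j, M j j = 0)
    (hmono : ∀ j (S : Finset (Fin n)), j ∉ S → 0 ≤ m j + ∑ s ∈ S, M j s) :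
    Monotone (CI2 n m M) := by
  intro P Q hPQ
  suffices h : ∀ T : Finset (Fin n), CI2 n m M P ≤ CI2 n m M (T.piecewise Q P) by
    simpa using h Finset.univ
  intro T
  induction T using Finset.induction_on with
  | empty => simp
  | insert j T hj ih =>
    rw [Finset.piecewise_insert]
    refine ih.trans (CI2_le_update hsymm hdiag hmono _ j ?_)
    simpa [hj] using hPQ j

theorem outrank_self {X : Type*} {n : ℕ} (m : Fin n → ℝ) (M : Fin n → Fin n → ℝ)
    (g : X → Fin n → ℝ) {F : Fin n → ℝ → ℝ} (hF : ∀ j, F j 0 = 0) (x : X) :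
    outrank n m M g F x x = 0 := by
  simp [outrank, CI2, hF]

theorem negFlow_eq_sum {X : Type*} [DecidableEq X] {π : X → X → ℝ} {x : X}
    (hπ : π x x = 0) (S : Finset X) :
    negFlow π S x = (1 / ((S.card : ℝ) - 1)) * ∑ y ∈ S, π y x := by
  rw [negFlow, Finset.sum_erase (f := fun y => π y x) S hπ]

/-- Proposition 1, negative flows: the negative Choquet-flows of the
reference profiles strictly increase along the ordered categories, within
`R_a = {r 0, …, r k, a}`. -/
theorem prop1_negFlow {X : Type*} [DecidableEq X] (n k : ℕ)
    (m : Fin n → ℝ) (M : Fin n → Fin n → ℝ)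
    (hsymm : ∀ j s, M j s = M s j) (hdiag : ∀ j, M j j = 0)
    (hmono1 : ∀ j, 0 ≤ m j)
    (hmono2 : ∀ j (S : Finset (Fin n)), j ∉ S → 0 ≤ m j + ∑ s ∈ S, M j s)
    (g : X → Fin n → ℝ) (F : Fin n → ℝ → ℝ)
    (hF1 : ∀ j, Monotone (F j))
    (hF2 : ∀ j d, 0 ≤ F j d ∧ F j d ≤ 1)
    (hF3 : ∀ j d, d ≤ 0 → F j d = 0)
    (r : Fin (k + 1) → X)
    (hinj : Function.Injective r)
    (hcond2 : ∀ h l : Fin (k + 1), h < l → ∀ j, g (r l) j ≤ g (r h) j)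
    (hcond7B : ∀ h : Fin k,
      0 < outrank n m M g F (r h.castSucc) (r h.succ))
    (a : X) (ha : ∀ h, a ≠ r h) :
    ∀ h : Fin k,
      negFlow (outrank n m M g F) (insert a (Finset.image r Finset.univ)) (r h.castSucc)
        < negFlow (outrank n m M g F) (insert a (Finset.image r Finset.univ))
          (r h.succ) := by
  intro h
  have hself := outrank_self m M g fun j => hF3 j 0 le_rfl
  rw [negFlow_eq_sum (hself _), negFlow_eq_sum (hself _)]
  have hmem : r h.castSucc ∈ insert a (Finset.image r Finset.univ) := by simp
  have hcard : (1 : ℝ) < (insert a (Finset.image r Finset.univ)).card := by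
    exact_mod_cast Finset.one_lt_card.2
      ⟨a, Finset.mem_insert_self _ _, r h.castSucc, hmem, ha _⟩
  refine mul_lt_mul_of_pos_left (Finset.sum_lt_sum (fun y _ => ?_) ⟨_, hmem, ?_⟩)
    (one_div_pos.2 (sub_pos.2 hcard))
  · exact CI2_mono hsymm hdiag hmono2 fun j =>
      hF1 j (sub_le_sub_left (hcond2 _ _ h.castSucc_lt_succ j) _)
  · rw [hself]
    exact hcond7B h
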